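/- arXiv:math/9901095 — 3 statements merged into one kernel-verified Lean document; each statement's English description precedes it below -/
import Mathlib

section
/- Let U be a vertex Lie algebra over ℂ. Let L₋(U) and L₊(U) be the images in L(U) of M₋(U) = ⊕_{n<0} U and M₊(U) = ⊕_{n≥0} U respectively. Then L₋(U) and L₊(U) are Lie subalgebras of L(U), both invariant under the derivation D of L(U), and L(U) = L₋(U) ⊕ L₊(U). Moreover the canonical maps induce linear isomorphisms L₋(U) ≅ M₋(U)/span{(Du)ₙ + n·u_{n−1} : u ∈ U, n < 0} and L₊(U) ≅ M₊(U)/span{(Du)ₙ + n·u_{n−1} : u ∈ U, n ≥ 0}. -/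
open scoped BigOperators

noncomputable section

/-- A vertex Lie algebra over `ℂ`. -/
structure VertexLie (U : Type*) [AddCommGroup U] [Module ℂ U] where
  D : U →ₗ[ℂ] U
  mul : ℕ → U →ₗ[ℂ] U →ₗ[ℂ] U
  trunc : ∀ u v : U, ∃ N : ℕ, ∀ n : ℕ, N ≤ n → mul n u v = 0
  dLeft : ∀ (n : ℕ) (u v : U), mul (n + 1) (D u) v = (-((n : ℂ) + 1)) • mul n u v
  dLeftZero : ∀ u v : U, mul 0 (D u) v = 0
  leibniz : ∀ (n : ℕ) (u v : U), D (mul n u v) = mul n (D u) v + mul n u (D v)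
  skew : ∀ (n : ℕ) (u v : U),
    mul n u v =
      -∑ᶠ k : ℕ, (((-1 : ℂ) ^ (n + k)) / (Nat.factorial k : ℂ)) • ((D ^ k) (mul (n + k) v u))
  jacobi : ∀ (k m n : ℕ) (u v w : U),
    ∑ᶠ i : ℕ, ((-1 : ℂ) ^ i * (Nat.choose k i : ℂ)) •
        (mul (m + k - i) u (mul (n + i) v w)
          - ((-1 : ℂ) ^ k) • mul (n + k - i) v (mul (m + i) u w))
      = ∑ᶠ i : ℕ, ((Nat.choose m i : ℂ)) • mul (m + n - i) (mul (k + i) u v) w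

/-- The generalized binomial coefficient `binom(n,i)` for `n : ℤ`, viewed in `ℂ`. -/
def zbinom (n : ℤ) (i : ℕ) : ℂ :=
  (∏ j ∈ Finset.range i, ((n : ℂ) - (j : ℂ))) / (Nat.factorial i : ℂ)

variable {U : Type*} [AddCommGroup U] [Module ℂ U]

/-- `K(U) ⊆ M(U) = ⊕_{n∈ℤ} U`, spanned by the elements `(Du)ₙ + n·u_{n−1}`. -/
def Ksub (A : VertexLie U) : Submodule ℂ (ℤ →₀ U) :=
  Submodule.span ℂ
    {x : ℤ →₀ U | ∃ (u : U) (n : ℤ),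
      x = Finsupp.single n (A.D u) + (n : ℂ) • Finsupp.single (n - 1) u}

/-- `L(U) = M(U)/K(U)`. -/
abbrev Lquot (A : VertexLie U) := (ℤ →₀ U) ⧸ Ksub A

/-- The characterization of the Lie bracket of `L(U)`. -/
def IsBracket (A : VertexLie U) (Bq : Lquot A →ₗ[ℂ] Lquot A →ₗ[ℂ] Lquot A) : Prop :=
  ∀ (n p : ℤ) (u v : U),
    Bq ((Ksub A).mkQ (Finsupp.single n u)) ((Ksub A).mkQ (Finsupp.single p v))
      = (Ksub A).mkQ (∑ᶠ i : ℕ, zbinom n i • Finsupp.single (n + p - (i : ℤ)) (A.mul i u v))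

/-- The characterization of the derivation `D` of `L(U)`: `uₙ ↦ (Du)ₙ`. -/
def IsDer (A : VertexLie U) (Dq : Lquot A →ₗ[ℂ] Lquot A) : Prop :=
  ∀ (n : ℤ) (u : U),
    Dq ((Ksub A).mkQ (Finsupp.single n u)) = (Ksub A).mkQ (Finsupp.single n (A.D u))

/-- `M₋(U) = ⊕_{n<0} U` inside `M(U)`. -/
def Mneg (U : Type*) [AddCommGroup U] [Module ℂ U] : Submodule ℂ (ℤ →₀ U) :=
  Finsupp.supported U ℂ {n : ℤ | n < 0}

/-- `M₊(U) = ⊕_{n≥0} U` inside `M(U)`. -/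
def Mpos (U : Type*) [AddCommGroup U] [Module ℂ U] : Submodule ℂ (ℤ →₀ U) :=
  Finsupp.supported U ℂ {n : ℤ | 0 ≤ n}

/-- `L₋(U)`, the image of `M₋(U)` in `L(U)`. -/
def Lneg (A : VertexLie U) : Submodule ℂ (Lquot A) := (Mneg U).map (Ksub A).mkQ

/-- `L₊(U)`, the image of `M₊(U)` in `L(U)`. -/
def Lpos (A : VertexLie U) : Submodule ℂ (Lquot A) := (Mpos U).map (Ksub A).mkQ


theorem supp_ind {W : Type*} [AddCommGroup W] [Module ℂ W] (s : Set ℤ) (f : (ℤ →₀ U) →ₗ[ℂ] W)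
    (S : Submodule ℂ W) (h : ∀ n ∈ s, ∀ u, f (Finsupp.single n u) ∈ S)
    (x : ℤ →₀ U) (hx : x ∈ Finsupp.supported U ℂ s) : f x ∈ S := by
  rw [← Finsupp.sum_single x, map_finsuppSum]
  exact Submodule.sum_mem _ fun n hn => h n (hx hn) _

theorem single_mem_supp (s : Set ℤ) (n : ℤ) (h : n ∈ s) (u : U) :
    Finsupp.single n u ∈ Finsupp.supported U ℂ s :=
  Finsupp.single_mem_supported ℂ u h

theorem single_mem_neg (n : ℤ) (h : n < 0) (u : U) : Finsupp.single n u ∈ Mneg U :=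
  single_mem_supp {n : ℤ | n < 0} n h u

theorem single_mem_pos (n : ℤ) (h : 0 ≤ n) (u : U) : Finsupp.single n u ∈ Mpos U :=
  single_mem_supp {n : ℤ | 0 ≤ n} n h u

theorem finsum_mem_sub {W : Type*} [AddCommGroup W] [Module ℂ W] (S : Submodule ℂ W)
    (f : ℕ → W) (h : ∀ i, f i ∈ S) : ∑ᶠ i, f i ∈ S :=
  finsum_induction (fun x => x ∈ S) S.zero_mem (fun _ _ => S.add_mem) h

theorem zbinom_zero (n : ℤ) (hn : 0 ≤ n) (i : ℕ) (h : n < i) : zbinom n i = 0 := by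
  unfold zbinom
  rw [Finset.prod_eq_zero (i := n.toNat), zero_div]
  · simp; omega
  · have : ((n.toNat : ℤ) : ℂ) = (n : ℂ) := by rw [Int.toNat_of_nonneg hn]
    rw [← this, Int.cast_natCast, sub_self]

theorem bracket_closed (A : VertexLie U) (s : Set ℤ)
    (hs : ∀ n ∈ s, ∀ p ∈ s, ∀ i : ℕ, zbinom n i = 0 ∨ n + p - (i : ℤ) ∈ s)
    (Bq : Lquot A →ₗ[ℂ] Lquot A →ₗ[ℂ] Lquot A) (hB : IsBracket A Bq) :
    ∀ x ∈ (Finsupp.supported U ℂ s).map (Ksub A).mkQ,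
    ∀ y ∈ (Finsupp.supported U ℂ s).map (Ksub A).mkQ,
      Bq x y ∈ (Finsupp.supported U ℂ s).map (Ksub A).mkQ := by
  rintro _ ⟨x, hx, rfl⟩ _ ⟨y, hy, rfl⟩
  refine supp_ind s ((Bq.flip ((Ksub A).mkQ y)).comp (Ksub A).mkQ) _ ?_ x hx
  intro n hn u
  refine supp_ind s ((Bq ((Ksub A).mkQ (Finsupp.single n u))).comp (Ksub A).mkQ) _ ?_ y hy
  intro p hp v
  rw [LinearMap.comp_apply, hB]
  refine Submodule.mem_map_of_mem (finsum_mem_sub _ _ fun i => ?_)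
  rcases hs n hn p hp i with h | h
  · rw [h, zero_smul]; exact Submodule.zero_mem _
  · exact Submodule.smul_mem _ _ (single_mem_supp s _ h _)

theorem der_closed (A : VertexLie U) (s : Set ℤ)
    (Dq : Lquot A →ₗ[ℂ] Lquot A) (hD : IsDer A Dq) :
    ∀ x ∈ (Finsupp.supported U ℂ s).map (Ksub A).mkQ,
      Dq x ∈ (Finsupp.supported U ℂ s).map (Ksub A).mkQ := by
  rintro _ ⟨x, hx, rfl⟩
  refine supp_ind s (Dq.comp (Ksub A).mkQ) _ ?_ x hx
  intro n hn u
  rw [LinearMap.comp_apply, hD]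
  exact Submodule.mem_map_of_mem (single_mem_supp s _ hn _)

/-- The span of the generators with negative index. -/
def Kneg (A : VertexLie U) : Submodule ℂ (ℤ →₀ U) := Submodule.span ℂ
          {y : ℤ →₀ U | ∃ (u : U) (n : ℤ), n < 0 ∧
            y = Finsupp.single n (A.D u) + (n : ℂ) • Finsupp.single (n - 1) u}

/-- The span of the generators with nonnegative index. -/
def Kpos (A : VertexLie U) : Submodule ℂ (ℤ →₀ U) := Submodule.span ℂ
          {y : ℤ →₀ U | ∃ (u : U) (n : ℤ), 0 ≤ n ∧
            y = Finsupp.single n (A.D u) + (n : ℂ) • Finsupp.single (n - 1) u}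

theorem Kneg_le (A : VertexLie U) : Kneg A ≤ Mneg U := by
  refine Submodule.span_le.2 ?_
  rintro _ ⟨u, n, hn, rfl⟩
  refine Submodule.add_mem _ (single_mem_neg _ hn _)
    (Submodule.smul_mem _ _ (single_mem_neg _ (by omega) _))

theorem Kpos_le (A : VertexLie U) : Kpos A ≤ Mpos U := by
  refine Submodule.span_le.2 ?_
  rintro _ ⟨u, n, hn, rfl⟩
  refine Submodule.add_mem _ (single_mem_pos _ hn _) ?_
  rcases hn.eq_or_lt with rfl | h
  · simp
  · refine Submodule.smul_mem _ _ (single_mem_pos _ (by omega) _)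

theorem Kneg_le_K (A : VertexLie U) : Kneg A ≤ Ksub A :=
  Submodule.span_mono fun _ ⟨u, n, _, h⟩ => ⟨u, n, h⟩

theorem Kpos_le_K (A : VertexLie U) : Kpos A ≤ Ksub A :=
  Submodule.span_mono fun _ ⟨u, n, _, h⟩ => ⟨u, n, h⟩

theorem K_le (A : VertexLie U) : Ksub A ≤ Kneg A ⊔ Kpos A := by
  refine Submodule.span_le.2 ?_
  rintro _ ⟨u, n, rfl⟩
  rcases lt_or_ge n 0 with h | h
  · exact (le_sup_left : Kneg A ≤ _) (Submodule.subset_span ⟨u, n, h, rfl⟩)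
  · exact (le_sup_right : Kpos A ≤ _) (Submodule.subset_span ⟨u, n, h, rfl⟩)

theorem M_disj (x : ℤ →₀ U) (h1 : x ∈ Mneg U) (h2 : x ∈ Mpos U) : x = 0 := by
  ext n
  by_contra h
  have hn : n ∈ x.support := Finsupp.mem_support_iff.2 h
  have a : n < 0 := h1 hn
  have b : 0 ≤ n := h2 hn
  omega

/-- If `x ∈ M₋`, `y ∈ M₊`, `x - y ∈ K`, then `x` and `y` lie in the partial spans. -/
theorem key (A : VertexLie U) (x y : ℤ →₀ U) (hx : x ∈ Mneg U) (hy : y ∈ Mpos U)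
    (h : x - y ∈ Ksub A) : x ∈ Kneg A ∧ y ∈ Kpos A := by
  obtain ⟨a, ha, b, hb, hab⟩ := Submodule.mem_sup.1 (K_le A h)
  have e : x - a = y + b := by
    rw [sub_eq_iff_eq_add, add_assoc, add_comm b a, hab]; abel
  have h0 : x - a = 0 := M_disj _ (Submodule.sub_mem _ hx (Kneg_le A ha))
    (e ▸ Submodule.add_mem _ hy (Kpos_le A hb))
  have h1 : y + b = 0 := e ▸ h0
  exact ⟨sub_eq_zero.1 h0 ▸ ha, eq_neg_of_add_eq_zero_left h1 ▸ Submodule.neg_mem _ hb⟩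

/-- `L₋(U)` and `L₊(U)` are `D`-invariant Lie subalgebras of `L(U)`,
`L(U) = L₋(U) ⊕ L₊(U)`, and the canonical maps induce isomorphisms of `L₋(U)` and
`L₊(U)` with the quotients of `M₋(U)` and `M₊(U)` by the spans of the corresponding
elements `(Du)ₙ + n·u_{n−1}` (expressed here by the kernel description of the
canonical map `M₋(U) → L₋(U)`, resp. `M₊(U) → L₊(U)`). -/
theorem stmt3 (A : VertexLie U) :
    (∀ Bq : Lquot A →ₗ[ℂ] Lquot A →ₗ[ℂ] Lquot A, IsBracket A Bq →
      (∀ x ∈ Lneg A, ∀ y ∈ Lneg A, Bq x y ∈ Lneg A) ∧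
      (∀ x ∈ Lpos A, ∀ y ∈ Lpos A, Bq x y ∈ Lpos A)) ∧
    (∀ Dq : Lquot A →ₗ[ℂ] Lquot A, IsDer A Dq →
      (∀ x ∈ Lneg A, Dq x ∈ Lneg A) ∧ (∀ x ∈ Lpos A, Dq x ∈ Lpos A)) ∧
    (Lneg A ⊔ Lpos A = ⊤) ∧ (Lneg A ⊓ Lpos A = ⊥) ∧
    (∀ x ∈ Mneg U,
      ((Ksub A).mkQ x = 0 ↔
        x ∈ Submodule.span ℂ
          {y : ℤ →₀ U | ∃ (u : U) (n : ℤ), n < 0 ∧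
            y = Finsupp.single n (A.D u) + (n : ℂ) • Finsupp.single (n - 1) u})) ∧
    (∀ x ∈ Mpos U,
      ((Ksub A).mkQ x = 0 ↔
        x ∈ Submodule.span ℂ
          {y : ℤ →₀ U | ∃ (u : U) (n : ℤ), 0 ≤ n ∧
            y = Finsupp.single n (A.D u) + (n : ℂ) • Finsupp.single (n - 1) u})) := by
  refine ⟨fun Bq hB => ⟨bracket_closed A _ ?_ Bq hB, bracket_closed A _ ?_ Bq hB⟩,
    fun Dq hD => ⟨der_closed A _ Dq hD, der_closed A _ Dq hD⟩, ?_, ?_, ?_, ?_⟩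
  · intro n hn p hp i
    right
    simp only [Set.mem_ofPred_eq] at *; omega
  · intro n hn p hp i
    simp only [Set.mem_ofPred_eq] at *
    rcases lt_or_ge n (i : ℤ) with h | h
    · exact Or.inl (zbinom_zero n hn i h)
    · right; omega
  · rw [eq_top_iff]
    rintro z -
    obtain ⟨x, rfl⟩ := (Ksub A).mkQ_surjective z
    refine supp_ind Set.univ (Ksub A).mkQ _ ?_ x (by simp [Finsupp.supported_univ])
    intro n _ u
    rcases lt_or_ge n 0 with h | h
    · exact (le_sup_left : Lneg A ≤ _) (Submodule.mem_map_of_mem (single_mem_neg _ h _))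
    · exact (le_sup_right : Lpos A ≤ _) (Submodule.mem_map_of_mem (single_mem_pos _ h _))
  · rw [eq_bot_iff]
    rintro _ ⟨⟨x, hx, rfl⟩, ⟨y, hy, hxy⟩⟩
    have h : x - y ∈ Ksub A := (Submodule.Quotient.eq _).1 hxy.symm
    have := Kneg_le_K A (key A x y hx hy h).1
    simpa using this
  · intro x hx
    rw [Submodule.mkQ_apply, Submodule.Quotient.mk_eq_zero]
    exact ⟨fun h => (key A x 0 hx (Submodule.zero_mem _) (by simpa using h)).1,
      fun h => Kneg_le_K A h⟩
  · intro x hx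
    rw [Submodule.mkQ_apply, Submodule.Quotient.mk_eq_zero]
    exact ⟨fun h => (key A 0 x (Submodule.zero_mem _) hx (by simpa using h)).2,
      fun h => Kpos_le_K A h⟩


end
end

section
/- Let U be a vertex Lie algebra over ℂ. The map ι_U : U → L₋(U), u ↦ u₋₁ (the class in L(U) of u placed in degree −1), is a linear isomorphism of U onto L₋(U), and ι_U∘D = D∘ι_U. Moreover, if φ : U → W is a homomorphism of vertex Lie algebras, then ι_W∘φ = L₋(φ)∘ι_U. -/
open scoped BigOperators

noncomputable section

variable {U : Type*} [AddCommGroup U] [Module ℂ U]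

/-- `ι_U : U → L(U)`, `u ↦ u₋₁`. -/
def iotaMap (A : VertexLie U) : U →ₗ[ℂ] Lquot A :=
  (Ksub A).mkQ ∘ₗ Finsupp.lsingle (-1)

/-- The retraction `M(U) → U`, `uₙ ↦ D^(-n-1) u / (-n-1)!` for `n < 0` and `0` otherwise. -/
def retr (A : VertexLie U) : (ℤ →₀ U) →ₗ[ℂ] U :=
  Finsupp.lsum ℂ (fun n : ℤ => if n < 0 then
    ((Nat.factorial (-n - 1).toNat : ℂ)⁻¹) • (A.D ^ (-n - 1).toNat) else 0)

lemma retr_neg (A : VertexLie U) (k : ℕ) (u : U) :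
    retr A (Finsupp.single (-((k : ℤ) + 1)) u) = ((Nat.factorial k : ℂ)⁻¹) • (A.D ^ k) u := by
  have h1 : -((k : ℤ) + 1) < 0 := by omega
  have h2 : (- -((k : ℤ) + 1) - 1).toNat = k := by omega
  simp only [retr, Finsupp.lsum_single, if_pos h1, h2, LinearMap.smul_apply]

lemma retr_pos (A : VertexLie U) (n : ℤ) (hn : 0 ≤ n) (u : U) :
    retr A (Finsupp.single n u) = 0 := by
  simp only [retr, Finsupp.lsum_single, if_neg (not_lt.mpr hn), LinearMap.zero_apply]

lemma Ksub_le_ker (A : VertexLie U) : Ksub A ≤ LinearMap.ker (retr A) := by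
  refine Submodule.span_le.mpr ?_
  rintro x ⟨u, n, rfl⟩
  rw [SetLike.mem_coe, LinearMap.mem_ker, map_add, map_smul]
  rcases lt_or_ge n 0 with hn | hn
  · obtain ⟨k, rfl⟩ : ∃ k : ℕ, n = -((k : ℤ) + 1) := ⟨(-n - 1).toNat, by omega⟩
    have h : -((k : ℤ) + 1) - 1 = -(((k + 1 : ℕ) : ℤ) + 1) := by push_cast; ring
    rw [h, retr_neg, retr_neg, pow_succ, Module.End.mul_apply, smul_smul, ← add_smul]
    have h0 : (Nat.factorial k : ℂ) ≠ 0 := by exact_mod_cast Nat.factorial_ne_zero k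
    have h1 : (k : ℂ) + 1 ≠ 0 := by exact_mod_cast Nat.succ_ne_zero k
    have : (Nat.factorial k : ℂ)⁻¹ + ((-((k : ℤ) + 1) : ℤ) : ℂ)
        * (Nat.factorial (k + 1) : ℂ)⁻¹ = 0 := by
      rw [Nat.factorial_succ]
      push_cast
      field_simp
      ring
    rw [this, zero_smul]
  · rw [retr_pos A n hn]
    rcases hn.eq_or_lt with rfl | h
    · simp
    · rw [retr_pos A (n - 1) (by omega)]; simp

lemma single_mem_range (A : VertexLie U) (k : ℕ) : ∀ u : U,
    (Ksub A).mkQ (Finsupp.single (-((k : ℤ) + 1)) u) ∈ LinearMap.range (iotaMap A) := by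
  induction k with
  | zero => intro u; exact ⟨u, by simp [iotaMap]⟩
  | succ k ih =>
    intro u
    have hk : Finsupp.single (-((k : ℤ) + 1)) (A.D u) + ((-((k : ℤ) + 1) : ℤ) : ℂ) •
        Finsupp.single (-((k : ℤ) + 1) - 1) u ∈ Ksub A :=
      Submodule.subset_span ⟨u, _, rfl⟩
    have h : -((k : ℤ) + 1) - 1 = -(((k + 1 : ℕ) : ℤ) + 1) := by push_cast; ring
    rw [h] at hk
    have hq := (Submodule.Quotient.mk_eq_zero (Ksub A)).mpr hk
    rw [← Submodule.mkQ_apply, map_add, map_smul] at hq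
    have hne : ((-((k : ℤ) + 1) : ℤ) : ℂ) ≠ 0 := by
      exact_mod_cast (show (-((k : ℤ) + 1) : ℤ) ≠ 0 by omega)
    refine (Submodule.smul_mem_iff _ hne).mp ?_
    rw [eq_neg_of_add_eq_zero_right hq]
    exact neg_mem (ih _)

/-- `ι_U : u ↦ u₋₁` is a linear isomorphism of `U` onto `L₋(U)` with
`ι_U ∘ D = D ∘ ι_U`; and for a homomorphism `φ : U → W` of vertex Lie algebras,
`ι_W ∘ φ = L₋(φ) ∘ ι_U`. -/
theorem stmt5 {W : Type*} [AddCommGroup W] [Module ℂ W]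
    (A : VertexLie U) (B : VertexLie W) :
    Function.Injective (iotaMap A) ∧
    LinearMap.range (iotaMap A) = Lneg A ∧
    (∀ Dq : Lquot A →ₗ[ℂ] Lquot A, IsDer A Dq →
      ∀ u : U, iotaMap A (A.D u) = Dq (iotaMap A u)) ∧
    (∀ φ : U →ₗ[ℂ] W,
      (∀ (n : ℕ) (u v : U), φ (A.mul n u v) = B.mul n (φ u) (φ v)) →
      (∀ u : U, φ (A.D u) = B.D (φ u)) →
      ∀ Lφ : Lquot A →ₗ[ℂ] Lquot B,
        (∀ (n : ℤ) (u : U),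
          Lφ ((Ksub A).mkQ (Finsupp.single n u)) = (Ksub B).mkQ (Finsupp.single n (φ u))) →
        ∀ u : U, iotaMap B (φ u) = Lφ (iotaMap A u)) := by
  refine ⟨?_, ?_, ?_, ?_⟩
  · intro u v huv
    have key : ∀ w : U, (Ksub A).liftQ (retr A) (Ksub_le_ker A) (iotaMap A w) = w := by
      intro w
      have := retr_neg A 0 w
      simpa [iotaMap] using this
    rw [← key u, huv, key v]
  · apply le_antisymm
    · rintro _ ⟨u, rfl⟩
      exact ⟨Finsupp.single (-1) u, Finsupp.single_mem_supported ℂ u (by simp), rfl⟩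
    · rintro _ ⟨x, hx, rfl⟩
      rw [← Finsupp.sum_single x, Finsupp.sum, map_sum]
      refine sum_mem fun n hn => ?_
      have hn0 : n < 0 := (Finsupp.mem_supported ℂ x).mp hx hn
      obtain ⟨k, rfl⟩ : ∃ k : ℕ, n = -((k : ℤ) + 1) := ⟨(-n - 1).toNat, by omega⟩
      exact single_mem_range A k _
  · intro Dq h u
    exact (h (-1) u).symm
  · intro φ _ _ Lφ h u
    exact (h (-1) u).symm

end
end

section
/- Let S be a formula over ℂ such that (a) ⟨Jacobi⟩ ⊆ D·(ℂ[D]⊗S) (the subspace of elements with zero constant term in D), and (b) Fₙ⁰(u,v) = −(−1)ⁿ·Fₙ⁰(v,u) for all u,v ∈ S and n ∈ ℕ (equivalently, uₙv + (−1)ⁿ·vₙu ∈ D·(ℂ[D]⊗S)). Then ⟨J+ss⟩ ⊆ D·(ℂ[D]⊗S); in particular S ∩ ⟨J+ss⟩ = 0, i.e. S is (J+ss)-injective. -/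
open scoped BigOperators

noncomputable section

variable {S : Type*} [AddCommGroup S] [Module ℂ S]

/-- The operator `D` on `ℂ[D]⊗S` (realized as `ℕ →₀ S`, where `Finsupp.single k u`
stands for `D^k ⊗ u`): it sends `D^k ⊗ u` to `D^{k+1} ⊗ u`. -/
def Dop (S : Type*) [AddCommGroup S] [Module ℂ S] : (ℕ →₀ S) →ₗ[ℂ] (ℕ →₀ S) :=
  Finsupp.lmapDomain S ℂ (fun k => k + 1)

/-- A formula over `ℂ`: a vector space `S` with bilinear maps
`Fₙ : S × S → ℂ[D]⊗S` (`n : ℕ`), vanishing for `n` sufficiently large. -/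
structure Formula (S : Type*) [AddCommGroup S] [Module ℂ S] where
  F : ℕ → S →ₗ[ℂ] S →ₗ[ℂ] (ℕ →₀ S)
  trunc : ∀ u v : S, ∃ N : ℕ, ∀ n : ℕ, N ≤ n → F n u v = 0

/-- The defining properties of the extension of the products of a formula `S`
to `ℂ[D]⊗S`: it agrees with `Fₙ` on `S`, and satisfies `(DA)ₙB = −n·A_{n−1}B`,
`(DA)₀B = 0` and `D(AₙB) = (DA)ₙB + Aₙ(DB)`. -/
def ExtProp (A : Formula S)
    (M : ℕ → (ℕ →₀ S) →ₗ[ℂ] (ℕ →₀ S) →ₗ[ℂ] (ℕ →₀ S)) : Prop :=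
  (∀ (n : ℕ) (u v : S), M n (Finsupp.single 0 u) (Finsupp.single 0 v) = A.F n u v) ∧
  (∀ (n : ℕ) (x y : ℕ →₀ S), M (n + 1) (Dop S x) y = (-((n : ℂ) + 1)) • M n x y) ∧
  (∀ x y : ℕ →₀ S, M 0 (Dop S x) y = 0) ∧
  (∀ (n : ℕ) (x y : ℕ →₀ S),
    Dop S (M n x y) = M n (Dop S x) y + M n x (Dop S y))


/-- A (two-sided, `D`-invariant) ideal of `ℂ[D]⊗S` with respect to the extended
products `M`. -/
def FIsIdeal (M : ℕ → (ℕ →₀ S) →ₗ[ℂ] (ℕ →₀ S) →ₗ[ℂ] (ℕ →₀ S))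
    (I : Submodule ℂ (ℕ →₀ S)) : Prop :=
  (∀ a ∈ I, Dop S a ∈ I) ∧
  ∀ (n : ℕ) (x : ℕ →₀ S), ∀ a ∈ I, M n x a ∈ I ∧ M n a x ∈ I

/-- The commutator defects of a formula, inside `ℂ[D]⊗S`. -/
def JDefects (A : Formula S)
    (M : ℕ → (ℕ →₀ S) →ₗ[ℂ] (ℕ →₀ S) →ₗ[ℂ] (ℕ →₀ S)) : Set (ℕ →₀ S) :=
  {x : ℕ →₀ S | ∃ (u v w : S) (m n : ℕ),
    x = M m (Finsupp.single 0 u) (M n (Finsupp.single 0 v) (Finsupp.single 0 w))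
      - M n (Finsupp.single 0 v) (M m (Finsupp.single 0 u) (Finsupp.single 0 w))
      - ∑ᶠ i : ℕ, ((Nat.choose m i : ℂ)) • M (m + n - i) (A.F i u v) (Finsupp.single 0 w)}

/-- The skew defects of a formula, inside `ℂ[D]⊗S`. -/
def SSDefects (A : Formula S) : Set (ℕ →₀ S) :=
  {x : ℕ →₀ S | ∃ (u v : S) (n : ℕ),
    x = A.F n u v
      + ∑ᶠ k : ℕ, (((-1 : ℂ) ^ (n + k)) / (Nat.factorial k : ℂ)) •
          ((Dop S ^ k) (A.F (n + k) v u))}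


/-- The subspace `D·(ℂ[D]⊗S)` of elements with zero constant term in `D`. -/
def Dpart (S : Type*) [AddCommGroup S] [Module ℂ S] : Submodule ℂ (ℕ →₀ S) :=
  LinearMap.ker (Finsupp.lapply 0 : (ℕ →₀ S) →ₗ[ℂ] S)

section helpers

open Filter

lemma Dop_single (k : ℕ) (u : S) :
    Dop S (Finsupp.single k u) = Finsupp.single (k + 1) u := by
  simp [Dop, Finsupp.lmapDomain_apply, Finsupp.mapDomain_single]

lemma Dop_zero_coeff (x : ℕ →₀ S) : (Dop S x) 0 = 0 := by
  simp only [Dop, Finsupp.lmapDomain_apply]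
  apply Finsupp.mapDomain_of_notMem_range
  simp

lemma V_ind {P : (ℕ →₀ S) → Prop} (hadd : ∀ x y, P x → P y → P (x + y))
    (hbase : ∀ u, P (Finsupp.single 0 u)) (hstep : ∀ x, P x → P (Dop S x)) : ∀ x, P x := by
  intro x
  induction x using Finsupp.induction_linear with
  | zero => simpa using hbase 0
  | add f g hf hg => exact hadd _ _ hf hg
  | single k u =>
    induction k with
    | zero => exact hbase u
    | succ k ih => rw [← Dop_single]; exact hstep _ ih

variable {A : Formula S} {M : ℕ → (ℕ →₀ S) →ₗ[ℂ] (ℕ →₀ S) →ₗ[ℂ] (ℕ →₀ S)}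

lemma M_Dr (hM : ExtProp A M) (n : ℕ) (x y : ℕ →₀ S) :
    M n x (Dop S y) = Dop S (M n x y) - M n (Dop S x) y := by
  rw [hM.2.2.2]; abel

lemma M_Dl (hM : ExtProp A M) (n : ℕ) (x y : ℕ →₀ S) :
    M n (Dop S x) y = (-(n : ℂ)) • M (n - 1) x y := by
  cases n with
  | zero => simp [hM.2.2.1]
  | succ n => simp [hM.2.1]

lemma M_trunc (hM : ExtProp A M) : ∀ x y : ℕ →₀ S, ∃ N : ℕ, ∀ n, N ≤ n → M n x y = 0 := by
  apply V_ind
  · intro x x' h h' y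
    obtain ⟨N, hN⟩ := h y
    obtain ⟨N', hN'⟩ := h' y
    refine ⟨N + N', fun n hn => ?_⟩
    rw [map_add, LinearMap.add_apply, hN n (by omega), hN' n (by omega), add_zero]
  · intro u
    apply V_ind
    · rintro y y' ⟨N, hN⟩ ⟨N', hN'⟩
      refine ⟨N + N', fun n hn => ?_⟩
      rw [map_add, hN n (by omega), hN' n (by omega), add_zero]
    · intro v
      obtain ⟨N, hN⟩ := A.trunc u v
      exact ⟨N, fun n hn => by rw [hM.1, hN n hn]⟩
    · rintro y ⟨N, hN⟩
      refine ⟨N + 1, fun n hn => ?_⟩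
      rw [M_Dr hM, M_Dl hM, hN n (by omega), hN (n - 1) (by omega)]
      simp
  · intro x h y
    obtain ⟨N, hN⟩ := h y
    refine ⟨N + 1, fun n hn => ?_⟩
    rw [M_Dl hM, hN (n - 1) (by omega), smul_zero]

/-- The `k`-th term of the opposite product. -/
def tm (M : ℕ → (ℕ →₀ S) →ₗ[ℂ] (ℕ →₀ S) →ₗ[ℂ] (ℕ →₀ S)) (n k : ℕ) (y x : ℕ →₀ S) : ℕ →₀ S :=
  (((-1 : ℂ) ^ (n + k)) / (Nat.factorial k : ℂ)) • ((Dop S ^ k) (M (n + k) y x))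

/-- The opposite product. -/
def sg (M : ℕ → (ℕ →₀ S) →ₗ[ℂ] (ℕ →₀ S) →ₗ[ℂ] (ℕ →₀ S)) (n : ℕ) (y x : ℕ →₀ S) : ℕ →₀ S :=
  ∑ᶠ k : ℕ, tm M n k y x

/-- The skew defect of general elements. -/
def sk (M : ℕ → (ℕ →₀ S) →ₗ[ℂ] (ℕ →₀ S) →ₗ[ℂ] (ℕ →₀ S)) (n : ℕ) (x y : ℕ →₀ S) : ℕ →₀ S :=
  M n x y + sg M n y x

lemma sg_ev (hM : ExtProp A M) (y x : ℕ →₀ S) :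
    ∀ᶠ N in atTop, ∀ n, sg M n y x = ∑ k ∈ Finset.range N, tm M n k y x := by
  obtain ⟨N, hN⟩ := M_trunc hM y x
  filter_upwards [eventually_ge_atTop N] with N' hN' n
  apply finsum_eq_finsetSum_of_support_subset
  intro k hk
  by_contra hk'
  apply hk
  simp only [Finset.coe_range, Set.mem_Iio, not_lt] at hk'
  simp only [tm]
  rw [hN _ (by omega)]
  simp

lemma sk_add_left (hM : ExtProp A M) (n : ℕ) (x x' y : ℕ →₀ S) :
    sk M n (x + x') y = sk M n x y + sk M n x' y := by
  obtain ⟨N, h1, h2, h3⟩ := ((sg_ev hM y x).and ((sg_ev hM y x').and (sg_ev hM y (x + x')))).exists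
  simp only [sk, h1, h2, h3, tm, map_add, LinearMap.add_apply, smul_add, Finset.sum_add_distrib]
  abel

lemma sk_add_right (hM : ExtProp A M) (n : ℕ) (x y y' : ℕ →₀ S) :
    sk M n x (y + y') = sk M n x y + sk M n x y' := by
  obtain ⟨N, h1, h2, h3⟩ := ((sg_ev hM y x).and ((sg_ev hM y' x).and (sg_ev hM (y + y') x))).exists
  simp only [sk, h1, h2, h3, tm, map_add, LinearMap.add_apply, smul_add, Finset.sum_add_distrib]
  abel

lemma sk_D (hM : ExtProp A M) (n : ℕ) (x y : ℕ →₀ S) :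
    Dop S (sk M n x y) = sk M n (Dop S x) y + sk M n x (Dop S y) := by
  obtain ⟨N, h1, h2, h3⟩ := ((sg_ev hM y x).and ((sg_ev hM (Dop S y) x).and
    (sg_ev hM y (Dop S x)))).exists
  have key : ∀ k, Dop S (tm M n k y x) = tm M n k y (Dop S x) + tm M n k (Dop S y) x := by
    intro k
    simp only [tm, map_smul]
    rw [← smul_add, ← map_add]
    congr 1
    rw [← Module.End.mul_apply, ← pow_succ', pow_succ, Module.End.mul_apply, hM.2.2.2, add_comm]
  simp only [sk, h1, h2, h3, map_add, map_sum, key, Finset.sum_add_distrib, hM.2.2.2]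
  abel

/-- Divided powers of `D`. -/
def dp (S : Type*) [AddCommGroup S] [Module ℂ S] (k : ℕ) : (ℕ →₀ S) →ₗ[ℂ] (ℕ →₀ S) :=
  ((Nat.factorial k : ℂ)⁻¹) • (Dop S ^ k)

lemma dp_succ (k : ℕ) (x : ℕ →₀ S) : ((k : ℂ) + 1) • dp S (k + 1) x = Dop S (dp S k x) := by
  simp only [dp, LinearMap.smul_apply, map_smul, smul_smul, pow_succ', Module.End.mul_apply]
  congr 1
  rw [Nat.factorial_succ]
  have : (Nat.factorial k : ℂ) ≠ 0 := by exact_mod_cast Nat.factorial_ne_zero k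
  have : (k : ℂ) + 1 ≠ 0 := by exact_mod_cast k.succ_ne_zero
  push_cast
  field_simp

lemma tm_dp (n k : ℕ) (y x : ℕ →₀ S) :
    tm M n k y x = (-1 : ℂ) ^ (n + k) • dp S k (M (n + k) y x) := by
  simp only [tm, dp, LinearMap.smul_apply, smul_smul, div_eq_mul_inv]

lemma tm_Dr (hM : ExtProp A M) (n k : ℕ) (y x : ℕ →₀ S) :
    tm M n k y (Dop S x) = Dop S (tm M n k y x)
      + ((-1 : ℂ) ^ (n + k) * (n + k)) • dp S k (M (n + k - 1) y x) := by
  have hc : dp S k (Dop S (M (n + k) y x)) = Dop S (dp S k (M (n + k) y x)) := by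
    simp only [dp, LinearMap.smul_apply, map_smul]
    rw [← Module.End.mul_apply, ← pow_succ, pow_succ', Module.End.mul_apply]
  simp only [tm_dp, M_Dr hM, M_Dl hM, map_sub, map_smul, hc]
  push_cast
  module

lemma D_tm (n k : ℕ) (y x : ℕ →₀ S) :
    Dop S (tm M n k y x) = ((-1 : ℂ) ^ (n + k) * (k + 1)) • dp S (k + 1) (M (n + k) y x) := by
  rw [tm_dp, map_smul, ← dp_succ, smul_smul]

lemma sk_Dl (hM : ExtProp A M) (n : ℕ) (x y : ℕ →₀ S) :
    sk M n (Dop S x) y = (-(n : ℂ)) • sk M (n - 1) x y := by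
  obtain ⟨N₀, hN₀⟩ := M_trunc hM y x
  obtain ⟨N, h2, h3, h4⟩ := (((tendsto_add_atTop_nat 1).eventually (sg_ev hM y (Dop S x))).and
    ((eventually_ge_atTop N₀).and ((tendsto_add_atTop_nat 1).eventually (sg_ev hM y x)))).exists
  have key : ∀ K, ∑ k ∈ Finset.range (K + 1), tm M n k y (Dop S x)
      = (-(n : ℂ)) • ∑ k ∈ Finset.range (K + 1), tm M (n - 1) k y x
        + Dop S (tm M n K y x) := by
    intro K
    induction K with
    | zero =>
      simp only [zero_add, Finset.sum_range_one, tm_Dr hM]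
      cases n with
      | zero => simp
      | succ n =>
        simp only [tm_dp, Nat.add_sub_cancel, add_zero]
        push_cast
        rw [pow_succ]
        module
    | succ K ih =>
      rw [Finset.sum_range_succ, ih, Finset.sum_range_succ _ (K + 1), tm_Dr hM, D_tm n K]
      cases n with
      | zero =>
        simp only [zero_add, Nat.add_sub_cancel]
        push_cast
        rw [pow_succ]
        module
      | succ n =>
        rw [tm_dp (n + 1 - 1)]
        simp only [Nat.add_sub_cancel, show n + 1 + (K + 1) - 1 = n + (K + 1) by omega,
          show n + 1 + K = n + (K + 1) by omega]
        rw [show n + 1 + (K + 1) = n + (K + 1) + 1 by omega, pow_succ]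
        push_cast
        module
  have h5 : Dop S (tm M n N y x) = 0 := by
    rw [D_tm, hN₀ _ (by omega)]; simp
  simp only [sk, h2, h4, key, h5, M_Dl hM]
  module

lemma ss_base (hM : ExtProp A M) (x : ℕ →₀ S) :
    x ∈ SSDefects A ↔ ∃ u v n, x = sk M n (Finsupp.single 0 u) (Finsupp.single 0 v) := by
  simp only [SSDefects, sk, sg, tm, Set.mem_ofPred_eq, hM.1]

lemma sk_Dpart (hM : ExtProp A M)
    (hb : ∀ (n : ℕ) (u v : S), (A.F n u v) 0 = -(((-1 : ℂ) ^ n) • ((A.F n v u) 0))) :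
    ∀ (x y : ℕ →₀ S) (n : ℕ), sk M n x y ∈ Dpart S := by
  apply V_ind
  · intro x x' h h' y n
    rw [sk_add_left hM]
    exact add_mem (h _ _) (h' _ _)
  · intro u
    apply V_ind
    · intro x x' h h' n
      rw [sk_add_right hM]
      exact add_mem (h _) (h' _)
    · intro v n
      obtain ⟨N, h1⟩ := ((tendsto_add_atTop_nat 1).eventually
        (sg_ev hM (Finsupp.single 0 v) (Finsupp.single 0 u))).exists
      simp only [sk, h1, Finset.sum_range_succ', Dpart, LinearMap.mem_ker, Finsupp.lapply_apply]
      simp only [tm, pow_succ', Module.End.mul_apply, Finsupp.add_apply, Finsupp.finsetSum_apply,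
        Finsupp.smul_apply, Dop_zero_coeff, hM.1]
      simp [hb n u v]
    · intro y h n
      have := sk_D hM n (Finsupp.single 0 u) y
      rw [← sub_eq_iff_eq_add'] at this
      rw [← this, sk_Dl hM]
      refine sub_mem ?_ (Submodule.smul_mem _ _ (h _))
      simp [Dpart, Dop_zero_coeff]
  · intro x h y n
    rw [sk_Dl hM]
    exact Submodule.smul_mem _ _ (h _ _)

/-- Commutator formula for generators modulo the Jacobi ideal. -/
lemma jac (hM : ExtProp A M) {I : Submodule ℂ (ℕ →₀ S)} (hJ : JDefects A M ⊆ I)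
    (u v w : S) (m n : ℕ) :
    ∃ e ∈ I, M m (Finsupp.single 0 u) (M n (Finsupp.single 0 v) (Finsupp.single 0 w))
      = M n (Finsupp.single 0 v) (M m (Finsupp.single 0 u) (Finsupp.single 0 w))
      + ∑ i ∈ Finset.range (m + 1), (Nat.choose m i : ℂ) •
        M (m + n - i) (M i (Finsupp.single 0 u) (Finsupp.single 0 v)) (Finsupp.single 0 w) + e := by
  refine ⟨_, hJ ⟨u, v, w, m, n, rfl⟩, ?_⟩
  rw [finsum_eq_finsetSum_of_support_subset (s := Finset.range (m + 1))]
  · simp only [hM.1]; abel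
  · intro k hk
    by_contra hk'
    apply hk
    simp only [Finset.coe_range, Set.mem_Iio, not_lt] at hk'
    simp [Nat.choose_eq_zero_of_lt (show m < k by omega)]

lemma M_Dpow_left (hM : ExtProp A M) (k m : ℕ) (x y : ℕ →₀ S) :
    M m ((Dop S ^ k) x) y = ((-1 : ℂ) ^ k * (Nat.factorial k) * (Nat.choose m k)) • M (m - k) x y := by
  induction k generalizing m with
  | zero => simp
  | succ k ih =>
    rw [pow_succ', Module.End.mul_apply, M_Dl hM]
    cases m with
    | zero => simp
    | succ m =>
      simp only [Nat.add_sub_cancel, ih, smul_smul, Nat.reduceSubDiff]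
      congr 1
      have := Nat.add_one_mul_choose_eq m k
      have h2 : ((m : ℂ) + 1) * (m.choose k) = ((m + 1).choose (k + 1)) * (k + 1) := by
        exact_mod_cast this
      rw [Nat.factorial_succ]
      push_cast
      linear_combination (-(-1 : ℂ) ^ k * (Nat.factorial k)) * h2

/-- Auxiliary: two-sided symmetric binomial sums. -/
def Gs (M : ℕ → (ℕ →₀ S) →ₗ[ℂ] (ℕ →₀ S) →ₗ[ℂ] (ℕ →₀ S)) (x y z : ℕ →₀ S) (n p q : ℕ) : ℕ →₀ S :=
  ∑ i ∈ Finset.range (p + 1), (Nat.choose p i : ℂ) • M (p + q - i) (M (n + i) x y) z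

lemma Gs_rec (x y z : ℕ →₀ S) (n p q : ℕ) :
    Gs M x y z (n + 1) p q = Gs M x y z n (p + 1) q - Gs M x y z n p (q + 1) := by
  have h1 : Gs M x y z n p (q + 1) = ∑ i ∈ Finset.range (p + 1 + 1), (Nat.choose p i : ℂ) •
      M (p + (q + 1) - i) (M (n + i) x y) z := by
    rw [Finset.sum_range_succ]
    simp [Gs]
  rw [h1]
  unfold Gs
  rw [← Finset.sum_sub_distrib, Finset.sum_range_succ' _ (p + 1)]
  simp only [Nat.choose_zero_right, Nat.choose_succ_succ, Nat.cast_add]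
  rw [show p + (q + 1) = p + 1 + q by omega]
  simp only [sub_self, add_zero, ← sub_smul, add_sub_cancel_right]
  apply Finset.sum_congr rfl
  intro i hi
  rw [show p + 1 + q - (i + 1) = p + q - i by omega, show n + 1 + i = n + (i + 1) by omega]

lemma Gs_mem (hM : ExtProp A M) {I : Submodule ℂ (ℕ →₀ S)} (hJ : JDefects A M ⊆ I)
    (u v w : S) (n p q : ℕ) :
    Gs M (Finsupp.single 0 u) (Finsupp.single 0 v) (Finsupp.single 0 w) n p q + (-1 : ℂ) ^ n •
      Gs M (Finsupp.single 0 v) (Finsupp.single 0 u) (Finsupp.single 0 w) n q p ∈ I := by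
  induction n generalizing p q with
  | zero =>
    obtain ⟨e, he, h⟩ := jac hM hJ u v w p q
    obtain ⟨e', he', h'⟩ := jac hM hJ v u w q p
    have : Gs M (Finsupp.single 0 u) (Finsupp.single 0 v) (Finsupp.single 0 w) 0 p q
      + (-1 : ℂ) ^ 0 •
      Gs M (Finsupp.single 0 v) (Finsupp.single 0 u) (Finsupp.single 0 w) 0 q p = -(e + e') := by
      rw [h'] at h
      simp only [Gs, zero_add, pow_zero, one_smul]
      rw [← sub_eq_zero] at h ⊢
      rw [← neg_eq_zero, ← h]
      abel
    rw [this]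
    exact neg_mem (add_mem he he')
  | succ n ih =>
    have := sub_mem (ih (p + 1) q) (ih p (q + 1))
    rw [Gs_rec, Gs_rec]
    convert this using 1
    rw [pow_succ]
    module

lemma sk_right_base (hM : ExtProp A M) {I : Submodule ℂ (ℕ →₀ S)} (hJ : JDefects A M ⊆ I)
    (u v w : S) (n m : ℕ) :
    M m (sk M n (Finsupp.single 0 u) (Finsupp.single 0 v)) (Finsupp.single 0 w) ∈ I := by
  have h := Gs_mem hM hJ u v w n 0 m
  obtain ⟨N, h1, h2⟩ := ((sg_ev hM (Finsupp.single 0 v) (Finsupp.single 0 u)).and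
    (eventually_ge_atTop (m + 1))).exists
  convert h using 1
  simp only [sk, h1, map_add, map_sum, LinearMap.add_apply, LinearMap.sum_apply, Gs, tm, map_smul,
    LinearMap.smul_apply, M_Dpow_left hM, Finset.smul_sum, smul_smul]
  rw [← Finset.sum_subset (Finset.range_mono h2)]
  · simp only [zero_add, Finset.sum_range_one, Nat.choose_self, Nat.sub_zero, add_zero,
      Nat.cast_one, one_smul]
    congr 1
    apply Finset.sum_congr rfl
    intro k hk
    congr 1
    have : (Nat.factorial k : ℂ) ≠ 0 := by exact_mod_cast Nat.factorial_ne_zero k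
    field_simp
    rw [pow_add, mul_assoc ((-1 : ℂ) ^ n), ← mul_pow]
    simp [mul_comm]
  · intro k _ hk
    simp only [Finset.mem_range, not_lt] at hk
    simp [Nat.choose_eq_zero_of_lt (show m < k by omega)]

lemma sk_Dr (hM : ExtProp A M) (n : ℕ) (x y : ℕ →₀ S) :
    sk M n x (Dop S y) = Dop S (sk M n x y) - (-(n : ℂ)) • sk M (n - 1) x y := by
  rw [sk_D hM, sk_Dl hM]; abel

lemma sk_right (hM : ExtProp A M) {I : Submodule ℂ (ℕ →₀ S)} (hI : FIsIdeal M I)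
    (hJ : JDefects A M ⊆ I) :
    ∀ (z x y : ℕ →₀ S) (n m : ℕ), M m (sk M n x y) z ∈ I := by
  apply V_ind
  · intro z z' h h' x y n m
    rw [map_add]
    exact add_mem (h _ _ _ _) (h' _ _ _ _)
  · intro w
    apply V_ind
    · intro x x' h h' y n m
      rw [sk_add_left hM, map_add]
      exact add_mem (h _ _ _) (h' _ _ _)
    · intro u
      apply V_ind
      · intro x x' h h' n m
        rw [sk_add_right hM, map_add]
        exact add_mem (h _ _) (h' _ _)
      · intro v n m
        exact sk_right_base hM hJ u v w n m
      · intro y h n m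
        rw [sk_Dr hM, map_sub, map_smul, LinearMap.sub_apply, LinearMap.smul_apply, M_Dl hM]
        exact sub_mem (Submodule.smul_mem _ _ (h _ _)) (Submodule.smul_mem _ _ (h _ _))
    · intro x h y n m
      rw [sk_Dl hM, map_smul, LinearMap.smul_apply]
      exact Submodule.smul_mem _ _ (h _ _ _)
  · intro z h x y n m
    rw [M_Dr hM, M_Dl hM]
    exact sub_mem (hI.1 _ (h _ _ _ _)) (Submodule.smul_mem _ _ (h _ _ _ _))

lemma binom_inv {V : Type*} [AddCommGroup V] [Module ℂ V] (g : ℕ → V) (m : ℕ) :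
    ∑ j ∈ Finset.range (m + 1), ((m.choose j : ℂ) * (-1) ^ j) •
      ∑ i ∈ Finset.range (m - j + 1), ((m - j).choose i : ℂ) • g i = g m := by
  let φ : Polynomial ℂ →ₗ[ℂ] V := Polynomial.lsum (fun i => LinearMap.toSpanSingleton ℂ V (g i))
  have hφ : ∀ i, φ (Polynomial.X ^ i) = g i := by
    intro i
    simp [φ, Polynomial.lsum_apply, ← Polynomial.monomial_one_right_eq_X_pow]
  have h : (Polynomial.X : Polynomial ℂ) ^ m = ∑ j ∈ Finset.range (m + 1),
      ((m.choose j : ℂ) * (-1) ^ j) •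
      ∑ i ∈ Finset.range (m - j + 1), ((m - j).choose i : ℂ) • Polynomial.X ^ i := by
    have h1 : (Polynomial.X : Polynomial ℂ) = -1 + (Polynomial.X + 1) := by ring
    conv_lhs => rw [h1, add_pow]
    apply Finset.sum_congr rfl
    intro j _
    rw [add_pow]
    simp only [Polynomial.smul_eq_C_mul, map_mul, map_pow, map_neg, map_one, map_natCast, one_pow,
      mul_one]
    simp only [mul_comm (Polynomial.X ^ _)]
    ring
  rw [← hφ m, h]
  simp only [map_sum, map_smul, hφ]

lemma M_smul_cancel {k : ℕ} {a b : ℕ →₀ S} (h : ((k : ℂ) + 1) • a = ((k : ℂ) + 1) • b) :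
    a = b := by
  have : (k : ℂ) + 1 ≠ 0 := by exact_mod_cast k.succ_ne_zero
  exact smul_right_injective _ this h

/-- Shifted divided powers. -/
def ds (S : Type*) [AddCommGroup S] [Module ℂ S] (k j : ℕ) : (ℕ →₀ S) →ₗ[ℂ] (ℕ →₀ S) :=
  if j ≤ k then dp S (k - j) else 0

lemma D_ds (k j : ℕ) (a : ℕ →₀ S) :
    Dop S (ds S k j a) = ((k : ℂ) + 1 - j) • ds S (k + 1) j a := by
  rcases Nat.lt_trichotomy j (k + 1) with h | h | h
  · obtain ⟨l, rfl⟩ := Nat.exists_eq_add_of_le (show j ≤ k by omega)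
    have h1 : j + l + 1 - j = l + 1 := by omega
    simp only [ds, if_pos (show j ≤ j + l by omega), if_pos (show j ≤ j + l + 1 by omega), h1,
      Nat.add_sub_cancel_left, ← dp_succ]
    congr 1
    push_cast
    ring
  · subst h
    simp [ds]
  · simp [ds, show ¬ j ≤ k by omega, show ¬ j ≤ k + 1 by omega]

lemma ds_succ (k j : ℕ) : ds S (k + 1) (j + 1) = ds S k j := by
  simp [ds]

lemma M_dp_right (hM : ExtProp A M) (k m : ℕ) (x a : ℕ →₀ S) :
    M m x (dp S k a) = ∑ j ∈ Finset.range (m + 1), (m.choose j : ℂ) • ds S k j (M (m - j) x a) := by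
  induction k generalizing m with
  | zero =>
    rw [Finset.sum_range_succ']
    simp [ds, dp]
  | succ k ih =>
    apply M_smul_cancel (k := k)
    rw [← map_smul, dp_succ, M_Dr hM, M_Dl hM, ih, ih]
    simp only [map_sum, map_smul, D_ds]
    have hsplit : ((k : ℂ) + 1) • ∑ j ∈ Finset.range (m + 1),
          (m.choose j : ℂ) • ds S (k + 1) j (M (m - j) x a)
        = ∑ j ∈ Finset.range (m + 1),
          (m.choose j : ℂ) • ((k : ℂ) + 1 - j) • ds S (k + 1) j (M (m - j) x a)
        + ∑ j ∈ Finset.range (m + 1),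
          ((m.choose j : ℂ) * j) • ds S (k + 1) j (M (m - j) x a) := by
      rw [Finset.smul_sum, ← Finset.sum_add_distrib]
      apply Finset.sum_congr rfl
      intro j _
      module
    rw [hsplit, Finset.sum_range_succ' (fun j => ((m.choose j : ℂ) * j) • _)]
    cases m with
    | zero => simp
    | succ m =>
      simp only [Nat.add_sub_cancel, neg_smul, sub_neg_eq_add, Nat.cast_zero, mul_zero, zero_smul,
        add_zero]
      congr 1
      rw [Finset.smul_sum]
      apply Finset.sum_congr rfl
      intro j _
      rw [ds_succ, smul_smul, show m + 1 - (j + 1) = m - j by omega]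
      congr 1
      exact_mod_cast Nat.add_one_mul_choose_eq m j

lemma ds_sum (N j : ℕ) (b : ℕ → (ℕ →₀ S)) (hb : ∀ k, N ≤ k → b k = 0) :
    ∑ k ∈ Finset.range N, ds S k j (b k) = ∑ l ∈ Finset.range N, dp S l (b (j + l)) := by
  have h1 : ∑ k ∈ Finset.range N, ds S k j (b k) = ∑ k ∈ Finset.range (j + N), ds S k j (b k) := by
    apply Finset.sum_subset (Finset.range_mono (by omega))
    intro k _ hk
    simp only [Finset.mem_range, not_lt] at hk
    rw [hb k hk, map_zero]
  rw [h1, Finset.sum_range_add, Finset.sum_eq_zero, zero_add]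
  · apply Finset.sum_congr rfl
    intro l _
    simp [ds]
  · intro k hk
    simp only [Finset.mem_range] at hk
    simp [ds, show ¬ j ≤ k by omega]

lemma dp_mem {I : Submodule ℂ (ℕ →₀ S)} (hI : FIsIdeal M I) (k : ℕ) {x : ℕ →₀ S} (hx : x ∈ I) :
    dp S k x ∈ I := by
  simp only [dp, LinearMap.smul_apply]
  apply Submodule.smul_mem
  induction k with
  | zero => simpa
  | succ k ih =>
    rw [pow_succ', Module.End.mul_apply]
    exact hI.1 _ ih

lemma sg_left_base (hM : ExtProp A M) {I : Submodule ℂ (ℕ →₀ S)} (hI : FIsIdeal M I)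
    (hJ : JDefects A M ⊆ I) (c v u : S) (n m : ℕ) :
    ∃ e ∈ I, M m (Finsupp.single 0 c) (sg M n (Finsupp.single 0 v) (Finsupp.single 0 u))
      = ∑ j ∈ Finset.range (m + 1), (m.choose j : ℂ) • sg M (n + j) (Finsupp.single 0 v)
          (M (m - j) (Finsupp.single 0 c) (Finsupp.single 0 u))
        + sg M n (M m (Finsupp.single 0 c) (Finsupp.single 0 v)) (Finsupp.single 0 u) + e := by
  have hjac := fun p q => jac hM hJ c v u p q
  choose e he hjac using hjac
  generalize Finsupp.single 0 c = C at *
  generalize Finsupp.single 0 v = B at *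
  generalize Finsupp.single 0 u = U at *
  obtain ⟨N₀, hN₀⟩ := M_trunc hM B U
  have hev : ∀ᶠ N in atTop, ∀ j ∈ Finset.range (m + 1), ∀ n, sg M n B (M (m - j) C U)
      = ∑ k ∈ Finset.range N, tm M n k B (M (m - j) C U) :=
    (Filter.eventually_all_finset _).2 (fun j _ => sg_ev hM _ _)
  obtain ⟨N, h1, h2, h3, h4⟩ := ((sg_ev hM B U).and ((sg_ev hM (M m C B) U).and
    (hev.and (eventually_ge_atTop N₀)))).exists
  have hA : M m C (sg M n B U) = ∑ j ∈ Finset.range (m + 1), (m.choose j : ℂ) •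
      ∑ l ∈ Finset.range N, (-1 : ℂ) ^ (n + (j + l)) • dp S l (M (m - j) C (M (n + (j + l)) B U)) := by
    simp only [h1, map_sum, tm_dp, map_smul, M_dp_right hM]
    simp only [Finset.smul_sum]
    rw [Finset.sum_comm]
    apply Finset.sum_congr rfl
    intro j _
    have := ds_sum N j (fun k => (-1 : ℂ) ^ (n + k) • M (m - j) C (M (n + k) B U)) (by
      intro k hk
      rw [hN₀ _ (by omega)]; simp)
    simp only [map_smul] at this
    rw [← Finset.smul_sum, ← this, Finset.smul_sum]
    apply Finset.sum_congr rfl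
    intro k _
    rw [smul_comm]
  have hB := binom_inv (fun i => ∑ l ∈ Finset.range N, (-1 : ℂ) ^ (n + l) •
    dp S l (M (m + n + l - i) (M i C B) U)) m
  have hB' : ∑ l ∈ Finset.range N, (-1 : ℂ) ^ (n + l) •
    dp S l (M (m + n + l - m) (M m C B) U) = sg M n (M m C B) U := by
    rw [h2]
    apply Finset.sum_congr rfl
    intro l _
    rw [tm_dp, show m + n + l - m = n + l by omega]
  refine ⟨∑ j ∈ Finset.range (m + 1), (m.choose j : ℂ) •
      ∑ l ∈ Finset.range N, (-1 : ℂ) ^ (n + (j + l)) • dp S l (e (m - j) (n + (j + l))), ?_, ?_⟩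
  · exact Submodule.sum_mem _ fun j _ => Submodule.smul_mem _ _ <| Submodule.sum_mem _ fun l _ =>
      Submodule.smul_mem _ _ (dp_mem hI _ (he _ _))
  · rw [hA, ← hB', ← hB, ← Finset.sum_add_distrib, ← Finset.sum_add_distrib]
    apply Finset.sum_congr rfl
    intro j hj
    have hj' : j < m + 1 := Finset.mem_range.1 hj
    rw [h3 j hj, mul_smul, ← smul_add, ← smul_add]
    congr 1
    have hC : (-1 : ℂ) ^ j • ∑ i ∈ Finset.range (m - j + 1), ((m - j).choose i : ℂ) •
        ∑ l ∈ Finset.range N, (-1 : ℂ) ^ (n + l) • dp S l (M (m + n + l - i) (M i C B) U)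
        = ∑ l ∈ Finset.range N, (-1 : ℂ) ^ (n + (j + l)) • dp S l
          (∑ i ∈ Finset.range (m - j + 1), ((m - j).choose i : ℂ) •
            M (m - j + (n + (j + l)) - i) (M i C B) U) := by
      simp only [Finset.smul_sum, map_sum, map_smul]
      rw [Finset.sum_comm]
      refine Finset.sum_congr rfl fun l _ => Finset.sum_congr rfl fun i _ => ?_
      rw [show m - j + (n + (j + l)) - i = m + n + l - i by omega]
      module
    rw [hC, ← Finset.sum_add_distrib, ← Finset.sum_add_distrib]
    apply Finset.sum_congr rfl
    intro l _
    rw [hjac, tm_dp, show n + j + l = n + (j + l) by omega]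
    simp only [map_add, smul_add]

lemma sk_left_base (hM : ExtProp A M) {I : Submodule ℂ (ℕ →₀ S)} (hI : FIsIdeal M I)
    (hJ : JDefects A M ⊆ I) (c u v : S) (n m : ℕ) :
    ∃ e ∈ I, M m (Finsupp.single 0 c) (sk M n (Finsupp.single 0 u) (Finsupp.single 0 v))
      = ∑ j ∈ Finset.range (m + 1), (m.choose j : ℂ) • sk M (n + j)
          (M (m - j) (Finsupp.single 0 c) (Finsupp.single 0 u)) (Finsupp.single 0 v)
        + sk M n (Finsupp.single 0 u) (M m (Finsupp.single 0 c) (Finsupp.single 0 v)) + e := by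
  obtain ⟨e, he, h⟩ := sg_left_base hM hI hJ c v u n m
  obtain ⟨e', he', h'⟩ := jac hM hJ c u v m n
  refine ⟨e + e', add_mem he he', ?_⟩
  rw [← Finset.sum_flip] at h'
  have hs : ∑ j ∈ Finset.range (m + 1), (m.choose (m - j) : ℂ) • M (m + n - (m - j))
      (M (m - j) (Finsupp.single 0 c) (Finsupp.single 0 u)) (Finsupp.single 0 v)
      = ∑ j ∈ Finset.range (m + 1), (m.choose j : ℂ) • M (n + j)
      (M (m - j) (Finsupp.single 0 c) (Finsupp.single 0 u)) (Finsupp.single 0 v) := by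
    apply Finset.sum_congr rfl
    intro j hj
    have hj' : j < m + 1 := Finset.mem_range.1 hj
    rw [Nat.choose_symm (by omega), show m + n - (m - j) = n + j by omega]
  rw [hs] at h'
  simp only [sk, map_add, h, h', smul_add, Finset.sum_add_distrib]
  abel

/-- The candidate ideal. -/
def KI (M : ℕ → (ℕ →₀ S) →ₗ[ℂ] (ℕ →₀ S) →ₗ[ℂ] (ℕ →₀ S)) (I : Submodule ℂ (ℕ →₀ S)) :
    Submodule ℂ (ℕ →₀ S) :=
  I ⊔ Submodule.span ℂ {s | ∃ n x y, s = sk M n x y}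

lemma sk_mem_KI (I : Submodule ℂ (ℕ →₀ S)) (n : ℕ) (x y : ℕ →₀ S) : sk M n x y ∈ KI M I :=
  Submodule.mem_sup_right (Submodule.subset_span ⟨n, x, y, rfl⟩)

lemma KI_ind {I : Submodule ℂ (ℕ →₀ S)} (L : (ℕ →₀ S) →ₗ[ℂ] (ℕ →₀ S))
    (J : Submodule ℂ (ℕ →₀ S)) (h1 : ∀ a ∈ I, L a ∈ J) (h2 : ∀ n x y, L (sk M n x y) ∈ J) :
    ∀ a ∈ KI M I, L a ∈ J := by
  have : KI M I ≤ J.comap L := by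
    apply sup_le h1
    rw [Submodule.span_le]
    rintro _ ⟨n, x, y, rfl⟩
    exact h2 n x y
  exact this

lemma KI_D (hM : ExtProp A M) {I : Submodule ℂ (ℕ →₀ S)} (hI : FIsIdeal M I) :
    ∀ a ∈ KI M I, Dop S a ∈ KI M I := by
  apply KI_ind
  · intro a ha
    exact Submodule.mem_sup_left (hI.1 a ha)
  · intro n x y
    rw [sk_D hM]
    exact add_mem (sk_mem_KI _ _ _ _) (sk_mem_KI _ _ _ _)

lemma sk_left (hM : ExtProp A M) {I : Submodule ℂ (ℕ →₀ S)} (hI : FIsIdeal M I)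
    (hJ : JDefects A M ⊆ I) :
    ∀ (x y z : ℕ →₀ S) (n m : ℕ), M m z (sk M n x y) ∈ KI M I := by
  apply V_ind
  · intro x x' h h' y z n m
    rw [sk_add_left hM, map_add]
    exact add_mem (h _ _ _ _) (h' _ _ _ _)
  · intro u
    apply V_ind
    · intro x x' h h' z n m
      rw [sk_add_right hM, map_add]
      exact add_mem (h _ _ _) (h' _ _ _)
    · intro v
      apply V_ind
      · intro z z' h h' n m
        rw [map_add]
        exact add_mem (h _ _) (h' _ _)
      · intro c n m
        obtain ⟨e, he, h⟩ := sk_left_base hM hI hJ c u v n m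
        rw [h]
        refine add_mem (add_mem ?_ (sk_mem_KI _ _ _ _)) (Submodule.mem_sup_left he)
        exact Submodule.sum_mem _ fun j _ => Submodule.smul_mem _ _ (sk_mem_KI _ _ _ _)
      · intro z h n m
        rw [M_Dl hM]
        exact Submodule.smul_mem _ _ (h _ _)
    · intro y h z n m
      rw [sk_Dr hM, map_sub, map_smul, M_Dr hM]
      exact sub_mem (sub_mem (KI_D hM hI _ (h _ _ _)) (h _ _ _)) (Submodule.smul_mem _ _ (h _ _ _))
  · intro x h y z n m
    rw [sk_Dl hM, map_smul]
    exact Submodule.smul_mem _ _ (h _ _ _ _)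

end helpers

/-- let `S` be a formula such that (a) `⟨Jacobi⟩ ⊆ D·(ℂ[D]⊗S)` and
(b) `Fₙ⁰(u,v) = −(−1)ⁿ·Fₙ⁰(v,u)` for all `u, v ∈ S`, `n ∈ ℕ`.  Then
`⟨J+ss⟩ ⊆ D·(ℂ[D]⊗S)`; in particular `S ∩ ⟨J+ss⟩ = 0`, i.e. `S` is
`(J+ss)`-injective. -/
theorem stmt17 (A : Formula S)
    (M : ℕ → (ℕ →₀ S) →ₗ[ℂ] (ℕ →₀ S) →ₗ[ℂ] (ℕ →₀ S)) (hM : ExtProp A M)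
    (IJ : Submodule ℂ (ℕ →₀ S)) (hIJ : FIsIdeal M IJ) (hJdef : JDefects A M ⊆ IJ)
    (hJmin : ∀ J : Submodule ℂ (ℕ →₀ S), FIsIdeal M J → JDefects A M ⊆ J → IJ ≤ J)
    (ha : IJ ≤ Dpart S)
    (hb : ∀ (n : ℕ) (u v : S), (A.F n u v) 0 = -(((-1 : ℂ) ^ n) • ((A.F n v u) 0))) :
    ∀ Iss : Submodule ℂ (ℕ →₀ S), FIsIdeal M Iss →
      JDefects A M ∪ SSDefects A ⊆ Iss →
      (∀ J : Submodule ℂ (ℕ →₀ S), FIsIdeal M J → JDefects A M ∪ SSDefects A ⊆ J →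
        Iss ≤ J) →
      Iss ≤ Dpart S ∧ ∀ u : S, Finsupp.single 0 u ∈ Iss → u = 0 := by
  intro Iss _ _ hmin
  have hK : FIsIdeal M (KI M IJ) := by
    refine ⟨KI_D hM hIJ, fun n x a haK => ⟨?_, ?_⟩⟩
    · exact KI_ind (M n x) _ (fun a h => Submodule.mem_sup_left (hIJ.2 n x a h).1)
        (fun k y z => sk_left hM hIJ hJdef _ _ _ _ _) a haK
    · exact KI_ind ((M n).flip x) _ (fun a h => Submodule.mem_sup_left (hIJ.2 n x a h).2)
        (fun k y z => Submodule.mem_sup_left (sk_right hM hIJ hJdef _ _ _ _ _)) a haK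
  have hsub : JDefects A M ∪ SSDefects A ⊆ KI M IJ := by
    rintro x (hx | hx)
    · exact Submodule.mem_sup_left (hJdef hx)
    · obtain ⟨u, v, n, rfl⟩ := (ss_base hM x).1 hx
      exact sk_mem_KI _ _ _ _
  have hle : Iss ≤ Dpart S := (hmin _ hK hsub).trans fun a haK =>
    KI_ind LinearMap.id (Dpart S) (fun a h => ha h) (fun n x y => sk_Dpart hM hb x y n) a haK
  refine ⟨hle, fun u hu => ?_⟩
  have := hle hu
  simpa [Dpart] using this


end
end
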